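/- Assume that every α_n is injective (with Im α_n ⊆ G_n) and that for every integer n the vector space λ_n is isomorphic to the n-th cohomology H^n(F) = ker d_n / Im d_{n-1}. Then the mapping cone Cone(α) is homotopy equivalent to the zero complex. -/

import Mathlib

/-- The differential of the mapping cone of a chain map `α : λ → F` of cochain
complexes, where `λ` has zero differentials.  The degree-`n` term of the cone is
`λ (n+1) × F n` and the differential sends `(a, x)` to `(0, α (n+1) a + d n x)`. -/
def mappingConeD (K : Type*) [Field K]
    (F : ℤ → Type*) [∀ n, AddCommGroup (F n)] [∀ n, Module K (F n)]
    (lam : ℤ → Type*) [∀ n, AddCommGroup (lam n)] [∀ n, Module K (lam n)]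
    (d : ∀ n : ℤ, F n →ₗ[K] F (n + 1))
    (α : ∀ n : ℤ, lam n →ₗ[K] F n) (n : ℤ) :
    (lam (n + 1) × F n) →ₗ[K] (lam (n + 1 + 1) × F (n + 1)) :=
  LinearMap.prod 0
    ((α (n + 1)).comp (LinearMap.fst K (lam (n + 1)) (F n)) +
      (d n).comp (LinearMap.snd K (lam (n + 1)) (F n)))

/-- `Cone(α)` is homotopy equivalent to the zero complex: equivalently, the identity
chain map of the cone is chain homotopic to the zero chain map. -/
def coneNullHomotopic (K : Type*) [Field K]
    (F : ℤ → Type*) [∀ n, AddCommGroup (F n)] [∀ n, Module K (F n)]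
    (lam : ℤ → Type*) [∀ n, AddCommGroup (lam n)] [∀ n, Module K (lam n)]
    (d : ∀ n : ℤ, F n →ₗ[K] F (n + 1))
    (α : ∀ n : ℤ, lam n →ₗ[K] F n) : Prop :=
  ∃ Ψ : ∀ n : ℤ, (lam (n + 1 + 1) × F (n + 1)) →ₗ[K] (lam (n + 1) × F n),
    ∀ n : ℤ,
      (mappingConeD K F lam d α n).comp (Ψ n) +
        (Ψ (n + 1)).comp (mappingConeD K F lam d α (n + 1)) = LinearMap.id


/-- Every linear map `f` between vector spaces has a generalized inverse `g`, that is,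
`f ∘ g ∘ f = f`. -/
theorem LinearMap.exists_generalized_inverse {K V W : Type*} [Field K]
    [AddCommGroup V] [Module K V] [AddCommGroup W] [Module K W] (f : V →ₗ[K] W) :
    ∃ g : W →ₗ[K] V, ∀ v, f (g (f v)) = f v := by
  obtain ⟨s, hs⟩ := f.rangeRestrict.exists_rightInverse_of_surjective f.range_rangeRestrict
  obtain ⟨g, hg⟩ := LinearMap.exists_extend s
  refine ⟨g, fun v => ?_⟩
  have h1 : g (f v) = s (f.rangeRestrict v) := LinearMap.congr_fun hg (f.rangeRestrict v)
  have h2 := congrArg Subtype.val (LinearMap.congr_fun hs (f.rangeRestrict v))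
  rw [h1]
  exact h2

/-- An exact complex of vector spaces has a contracting homotopy. -/
theorem exists_contraction_of_exact {K : Type*} [Field K]
    {C : ℤ → Type*} [∀ n, AddCommGroup (C n)] [∀ n, Module K (C n)]
    (D : ∀ n : ℤ, C n →ₗ[K] C (n + 1))
    (hD : ∀ n : ℤ, LinearMap.ker (D (n + 1)) = LinearMap.range (D n)) :
    ∃ Ψ : ∀ n : ℤ, C (n + 1) →ₗ[K] C n,
      ∀ n : ℤ, (D n).comp (Ψ n) + (Ψ (n + 1)).comp (D (n + 1)) = LinearMap.id := by
  choose h hh using fun n => (D n).exists_generalized_inverse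
  refine ⟨fun n => (h n).comp (LinearMap.id - (h (n + 1)).comp (D (n + 1))), fun n => ?_⟩
  ext x
  have hDD : D (n + 1 + 1) (D (n + 1) x) = 0 := by
    rw [← LinearMap.mem_ker, hD]
    exact LinearMap.mem_range_self _ x
  obtain ⟨y, hy⟩ : x - h (n + 1) (D (n + 1) x) ∈ LinearMap.range (D n) := by
    rw [← hD, LinearMap.mem_ker, map_sub, hh, sub_self]
  have hproj : D n (h n (x - h (n + 1) (D (n + 1) x))) = x - h (n + 1) (D (n + 1) x) := by
    rw [← hy, hh]
  simp only [LinearMap.add_apply, LinearMap.comp_apply, LinearMap.sub_apply, LinearMap.id_apply,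
    hDD, map_zero, sub_zero, hproj, sub_add_cancel]

/-- Let `f` be injective with image in `ker e`, meeting `range d` trivially. If the source of `f`
is isomorphic to the cohomology `ker e / range d`, then `range f` and `range d` span `ker e`. -/
theorem exists_add_eq_of_equiv_cohomology {K A V W L : Type*} [Field K]
    [AddCommGroup A] [Module K A] [AddCommGroup V] [Module K V] [AddCommGroup W] [Module K W]
    [AddCommGroup L] [Module K L] [FiniteDimensional K L]
    (d : A →ₗ[K] V) (e : V →ₗ[K] W) (f : L →ₗ[K] V)
    (hef : ∀ a, e (f a) = 0) (hf : Function.Injective f)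
    (hdisj : Disjoint (LinearMap.range f) (LinearMap.range d))
    (φ : L ≃ₗ[K] (↥(LinearMap.ker e) ⧸ (LinearMap.range d).comap (LinearMap.ker e).subtype))
    {x : V} (hx : e x = 0) : ∃ a y, f a + d y = x := by
  let q := ((LinearMap.range d).comap (LinearMap.ker e).subtype).mkQ.comp
    (f.codRestrict (LinearMap.ker e) hef)
  have hq : Function.Injective (φ.symm.toLinearMap.comp q) := by
    refine φ.symm.injective.comp ((injective_iff_map_eq_zero q).2 fun a ha => ?_)
    have hmem : f a ∈ LinearMap.range d := (Submodule.Quotient.mk_eq_zero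
      ((LinearMap.range d).comap (LinearMap.ker e).subtype)).1 ha
    have h0 := Submodule.disjoint_def.1 hdisj (f a) (LinearMap.mem_range_self f a) hmem
    exact hf (h0.trans (map_zero f).symm)
  obtain ⟨a, ha⟩ := LinearMap.injective_iff_surjective.1 hq
    (φ.symm (Submodule.Quotient.mk ⟨x, hx⟩))
  have hmem : x - f a ∈ LinearMap.range d :=
    (Submodule.Quotient.eq ((LinearMap.range d).comap (LinearMap.ker e).subtype)).1
      (φ.symm.injective ha).symm
  obtain ⟨y, hy⟩ := hmem
  exact ⟨a, y, by rw [hy, add_sub_cancel]⟩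

/-- If every `α n` is injective (with image inside `G n`) and every `λ n` is
isomorphic to `H^n(F) = ker d_n / Im d_{n-1}` (stated at degree `n + 1`, which
ranges over all integers), then `Cone(α)` is homotopy equivalent to the zero
complex. -/
theorem stmt_6 (K : Type*) [Field K]
    (F : ℤ → Type*) [∀ n, AddCommGroup (F n)] [∀ n, Module K (F n)]
    [∀ n, FiniteDimensional K (F n)]
    (d : ∀ n : ℤ, F n →ₗ[K] F (n + 1))
    (hd : ∀ n : ℤ, (d (n + 1)).comp (d n) = 0)
    (G : ∀ n : ℤ, Submodule K (F n))
    (hG : ∀ n : ℤ, IsCompl (G (n + 1)) (LinearMap.range (d n)))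
    (lam : ℤ → Type*) [∀ n, AddCommGroup (lam n)] [∀ n, Module K (lam n)]
    [∀ n, FiniteDimensional K (lam n)]
    (α : ∀ n : ℤ, lam n →ₗ[K] F n)
    (hchain : ∀ n : ℤ, (d n).comp (α n) = 0)
    (hαG : ∀ n : ℤ, LinearMap.range (α n) ≤ G n)
    (hinj : ∀ n : ℤ, Function.Injective (α n))
    (hiso : ∀ n : ℤ, Nonempty
      (lam (n + 1) ≃ₗ[K]
        (↥(LinearMap.ker (d (n + 1))) ⧸
          (LinearMap.range (d n)).comap (LinearMap.ker (d (n + 1))).subtype))) :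
    coneNullHomotopic K F lam d α := by
  have hdisj : ∀ n, Disjoint (LinearMap.range (α (n + 1))) (LinearMap.range (d n)) :=
    fun n => (hG n).disjoint.mono_left (hαG (n + 1))
  refine exists_contraction_of_exact (mappingConeD K F lam d α) fun n => le_antisymm ?_ ?_
  · rintro ⟨a, x⟩ hax
    have hsum : α (n + 1 + 1) a + d (n + 1) x = 0 := congrArg Prod.snd hax
    have hmem : α (n + 1 + 1) a ∈ LinearMap.range (d (n + 1)) :=
      ⟨-x, by rw [map_neg, eq_neg_of_add_eq_zero_left hsum]⟩
    have hαa : α (n + 1 + 1) a = 0 :=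
      Submodule.disjoint_def.1 (hdisj (n + 1)) _ (LinearMap.mem_range_self _ a) hmem
    have ha : a = 0 := hinj _ (hαa.trans (map_zero _).symm)
    have hx : d (n + 1) x = 0 := by rwa [hαa, zero_add] at hsum
    obtain ⟨φ⟩ := hiso n
    obtain ⟨b, y, hby⟩ := exists_add_eq_of_equiv_cohomology (d n) (d (n + 1)) (α (n + 1))
      (LinearMap.congr_fun (hchain (n + 1))) (hinj (n + 1)) (hdisj n) φ hx
    exact ⟨(b, y), Prod.ext ha.symm hby⟩
  · rintro _ ⟨⟨b, y⟩, rfl⟩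
    have hα : d (n + 1) (α (n + 1) b) = 0 := LinearMap.congr_fun (hchain (n + 1)) b
    have hdd : d (n + 1) (d n y) = 0 := LinearMap.congr_fun (hd n) y
    simp [mappingConeD, hα, hdd]
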